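/- arXiv:1401.6869 — 7 statements merged into one kernel-verified Lean document; each statement's English description precedes it below -/
import Mathlib

section
/- Suppose that the proper function f : X → (−∞,+∞] is a c-antiderivative of the mapping M : X ⇉ Y and that ∅ ≠ S ⊆ dom M. Then f^{cc} ∈ 𝒜_{[c,f|_S,M]}; in particular 𝒜_{[c,f|_S,M]} is nonempty. Moreover, the upper envelope γ_{[c,f|_S,M]} belongs to 𝒜_{[c,f|_S,M]}, i.e. it is the maximal c-convex c-antiderivative of M agreeing with f on S. -/
/-- A function into `(-∞,+∞]` (modeled as `EReal` never taking `⊥`) is proper if it is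
finite somewhere. -/
def EProper {A : Type*} (f : A → EReal) : Prop :=
  (∀ a, f a ≠ ⊥) ∧ ∃ a, f a ≠ ⊤

/-- The `c`-transform `f^c(b) = sup_a (c(a,b) - f(a))`. -/
noncomputable def cTransform {A B : Type*} (k : A → B → ℝ) (f : A → EReal) : B → EReal :=
  fun b => ⨆ a, (k a b : EReal) - f a

/-- The `c`-subdifferential `∂_c f(a) = {b | ∀ a', f(a) + c(a',b) ≤ f(a') + c(a,b)}`. -/
def cSubdiff {A B : Type*} (k : A → B → ℝ) (f : A → EReal) (a : A) : Set B :=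
  {b | ∀ a', f a + (k a' b : EReal) ≤ f a' + (k a b : EReal)}

/-- A proper function `f` is `c`-convex if it is the `c`-transform of some
`(-∞,+∞]`-valued function on the other set. -/
def CConvexWith {A B : Type*} (k : A → B → ℝ) (f : A → EReal) : Prop :=
  EProper f ∧ ∃ g : B → EReal, (∀ b, g b ≠ ⊥) ∧ f = cTransform (fun b a => k a b) g

/-- `f` is a `c`-antiderivative of `M` if `G(M) ⊆ G(∂_c f)`. -/
def IsCAntideriv {A B : Type*} (k : A → B → ℝ) (f : A → EReal) (M : A → Set B) : Prop :=
  ∀ a b, b ∈ M a → b ∈ cSubdiff k f a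

/-- The family `𝒜_{[c,f|_S,M]}` of all `c`-convex `c`-antiderivatives of `M`
agreeing with `f` on `S`. -/
def AFam {A B : Type*} (k : A → B → ℝ) (f : A → EReal) (S : Set A) (M : A → Set B) :
    Set (A → EReal) :=
  {h | CConvexWith k h ∧ IsCAntideriv k h M ∧ ∀ s ∈ S, h s = f s}

theorem EReal.coe_sub_le_comm (r : ℝ) (s t : EReal) :
    (r : EReal) - s ≤ t ↔ (r : EReal) - t ≤ s := by
  have coe_sub_ne_bot (x : ℝ) : (r : EReal) - x ≠ ⊥ := EReal.coe_ne_bot (r - x)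
  induction s <;> induction t
  case coe.coe => norm_cast; exact sub_le_comm
  all_goals simp [coe_sub_ne_bot]

theorem cTransform_le_iff {A B : Type*} (k : A → B → ℝ) (f : A → EReal) (g : B → EReal) :
    cTransform k f ≤ g ↔ cTransform (fun b a => k a b) g ≤ f := by
  simp only [cTransform, Pi.le_def, iSup_le_iff]
  exact ⟨fun h a b => (EReal.coe_sub_le_comm _ _ _).1 (h b a),
    fun h b a => (EReal.coe_sub_le_comm _ _ _).1 (h a b)⟩

theorem cTransform_cTransform_le {A B : Type*} (k : A → B → ℝ) (f : A → EReal) :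
    cTransform (fun b a => k a b) (cTransform k f) ≤ f :=
  (cTransform_le_iff k f _).1 le_rfl

theorem cTransform_antitone {A B : Type*} (k : A → B → ℝ) : Antitone (cTransform k) :=
  fun _ _ h _ => iSup_mono fun a => EReal.sub_le_sub le_rfl (h a)

theorem EProper.cTransform_ne_bot {A B : Type*} {f : A → EReal} (hf : EProper f)
    (k : A → B → ℝ) (b : B) : cTransform k f b ≠ ⊥ := by
  obtain ⟨a, ha⟩ := hf.2
  refine ne_bot_of_le_ne_bot ?_ (le_iSup (fun a => (k a b : EReal) - f a) a)
  lift f a to ℝ using ⟨ha, hf.1 a⟩ with r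
  exact_mod_cast EReal.coe_ne_bot (k a b - r)

theorem CConvexWith.le_cTransform_cTransform {A B : Type*} {k : A → B → ℝ} {f : A → EReal}
    (hf : CConvexWith k f) : f ≤ cTransform (fun b a => k a b) (cTransform k f) := by
  obtain ⟨-, g, -, rfl⟩ := hf
  exact cTransform_antitone _ (cTransform_cTransform_le (fun b a => k a b) g)

/-- A proper function admitting a `c`-subgradient at a point is finite at that point. -/
theorem EProper.ne_top_of_mem_cSubdiff {A B : Type*} {k : A → B → ℝ} {f : A → EReal}
    (hf : EProper f) {a : A} {b : B} (hb : b ∈ cSubdiff k f a) : f a ≠ ⊤ := by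
  obtain ⟨a', ha'⟩ := hf.2
  intro h
  have := hb a'
  rw [h, EReal.top_add_coe, top_le_iff] at this
  lift f a' to ℝ using ⟨ha', hf.1 a'⟩ with r
  exact EReal.coe_ne_top (r + k a b) (by exact_mod_cast this)

theorem cTransform_le_of_mem_cSubdiff {A B : Type*} {k : A → B → ℝ} {f : A → EReal}
    (hf : EProper f) {a : A} {b : B} (hb : b ∈ cSubdiff k f a) :
    cTransform k f b ≤ (k a b : EReal) - f a := by
  refine iSup_le fun a' => ?_
  have h := hb a'
  lift f a to ℝ using ⟨hf.ne_top_of_mem_cSubdiff hb, hf.1 a⟩ with r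
  induction hs : f a' with
  | bot => exact absurd hs (hf.1 a')
  | top => simp
  | coe s =>
    rw [hs] at h
    norm_cast at h ⊢
    linarith

theorem add_le_cTransform_cTransform_add {A B : Type*} {k : A → B → ℝ} {f : A → EReal}
    (hf : EProper f) {a : A} {b : B} (hb : b ∈ cSubdiff k f a) (a' : A) :
    f a + (k a' b : EReal) ≤
      cTransform (fun b a => k a b) (cTransform k f) a' + (k a b : EReal) := by
  have h : (k a' b : EReal) - (k a b - f a) ≤
      cTransform (fun b a => k a b) (cTransform k f) a' :=
    (EReal.sub_le_sub le_rfl (cTransform_le_of_mem_cSubdiff hf hb)).trans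
      (le_iSup (fun b => (k a' b : EReal) - cTransform k f b) b)
  refine le_trans ?_ (add_le_add_left h _)
  lift f a to ℝ using ⟨hf.ne_top_of_mem_cSubdiff hb, hf.1 a⟩ with r
  norm_cast
  linarith

theorem cTransform_cTransform_eq_of_mem_cSubdiff {A B : Type*} {k : A → B → ℝ}
    {f : A → EReal} (hf : EProper f) {a : A} {b : B} (hb : b ∈ cSubdiff k f a) :
    cTransform (fun b a => k a b) (cTransform k f) a = f a :=
  le_antisymm (cTransform_cTransform_le k f a) <|
    (EReal.addLECancellable_coe (k a b)).add_le_add_iff_right.1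
      (add_le_cTransform_cTransform_add hf hb a)

theorem cTransform_cTransform_mem_AFam {A B : Type*} {k : A → B → ℝ} {f : A → EReal}
    (hf : EProper f) {M : A → Set B} (hM : IsCAntideriv k f M) {S : Set A}
    (hS : S.Nonempty) (hSdom : ∀ s ∈ S, (M s).Nonempty) :
    cTransform (fun b a => k a b) (cTransform k f) ∈ AFam k f S M := by
  refine ⟨⟨⟨fun a h => ?_, ?_⟩, _, hf.cTransform_ne_bot k, rfl⟩, fun a b hb a' => ?_,
    fun s hs => ?_⟩
  · obtain ⟨s, hs⟩ := hS
    obtain ⟨b, hb⟩ := hSdom s hs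
    have hle := add_le_cTransform_cTransform_add hf (hM s b hb) a
    rw [h, EReal.bot_add, le_bot_iff, EReal.add_eq_bot_iff] at hle
    exact hle.elim (hf.1 s) (EReal.coe_ne_bot _)
  · obtain ⟨a, ha⟩ := hf.2
    exact ⟨a, ne_top_of_le_ne_top ha (cTransform_cTransform_le k f a)⟩
  · rw [cTransform_cTransform_eq_of_mem_cSubdiff hf (hM a b hb)]
    exact add_le_cTransform_cTransform_add hf (hM a b hb) a'
  · obtain ⟨b, hb⟩ := hSdom s hs
    exact cTransform_cTransform_eq_of_mem_cSubdiff hf (hM s b hb)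

theorem iSup_AFam_mem {A B : Type*} {k : A → B → ℝ} {f : A → EReal} {M : A → Set B}
    {S : Set A} (hne : (AFam k f S M).Nonempty) (hS : S.Nonempty)
    (htop : ∀ s ∈ S, f s ≠ ⊤) :
    (fun a => ⨆ h ∈ AFam k f S M, h a) ∈ AFam k f S M := by
  set γ : A → EReal := fun a => ⨆ h ∈ AFam k f S M, h a with hγ
  have le_γ : ∀ h ∈ AFam k f S M, h ≤ γ := fun h hh a =>
    le_iSup₂ (f := fun h (_ : h ∈ AFam k f S M) => h a) h hh
  obtain ⟨h₀, hh₀⟩ := hne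
  have eq_on : ∀ s ∈ S, γ s = f s := fun s hs =>
    le_antisymm (iSup₂_le fun h hh => (hh.2.2 s hs).le) (hh₀.2.2 s hs ▸ le_γ h₀ hh₀ s)
  have proper : EProper γ := by
    refine ⟨fun a => ne_bot_of_le_ne_bot (hh₀.1.1.1 a) (le_γ h₀ hh₀ a), ?_⟩
    obtain ⟨s, hs⟩ := hS
    exact ⟨s, eq_on s hs ▸ htop s hs⟩
  refine ⟨⟨proper, cTransform k γ, proper.cTransform_ne_bot k, le_antisymm ?_ ?_⟩,
    fun a b hb a' => ?_, eq_on⟩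
  · exact fun a => iSup₂_le fun h hh => (hh.1.le_cTransform_cTransform.trans
      (cTransform_antitone _ (cTransform_antitone _ (le_γ h hh)))) a
  · exact cTransform_cTransform_le k γ
  · rw [← EReal.le_sub_iff_add_le (.inl (EReal.coe_ne_bot _)) (.inl (EReal.coe_ne_top _))]
    refine iSup₂_le fun h hh => ?_
    rw [EReal.le_sub_iff_add_le (.inl (EReal.coe_ne_bot _)) (.inl (EReal.coe_ne_top _))]
    exact (hh.2.1 a b hb a').trans (add_le_add_left (le_γ h hh a') _)

/-- `f^{cc} ∈ 𝒜_{[c,f|_S,M]}`, so the family is nonempty, and its upper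
envelope `γ_{[c,f|_S,M]}` also belongs to it. -/
theorem AFam_nonempty_and_upperEnvelope_mem {X Y : Type*} [Nonempty X] [Nonempty Y]
    (c : X → Y → ℝ) (f : X → EReal) (hf : EProper f) (M : X → Set Y)
    (hanti : IsCAntideriv c f M) (S : Set X) (hS : S.Nonempty)
    (hSdom : ∀ s ∈ S, (M s).Nonempty) :
    cTransform (fun y x => c x y) (cTransform c f) ∈ AFam c f S M ∧
    (AFam c f S M).Nonempty ∧
    (fun x => ⨆ h ∈ AFam c f S M, h x) ∈ AFam c f S M := by
  have hmem := cTransform_cTransform_mem_AFam hf hanti hS hSdom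
  refine ⟨hmem, ⟨_, hmem⟩, iSup_AFam_mem ⟨_, hmem⟩ hS fun s hs => ?_⟩
  obtain ⟨y, hy⟩ := hSdom s hs
  exact hf.ne_top_of_mem_cSubdiff (hanti s y hy)
end

section
/- Suppose that the proper function f : X → (−∞,+∞] is a c-antiderivative of the mapping M : X ⇉ Y with dom M ≠ ∅, and take S = dom M. Then the lower envelope satisfies α_{[c,f|_{dom M},M]}(x) = sup_{(s,t)∈G(M)} [f(s) + c(x,t) − c(s,t)] for every x ∈ X. Moreover, if h : X → (−∞,+∞] is c-convex, then h ∈ 𝒜_{[c,f|_{dom M},M]} if and only if α_{[c,f|_{dom M},M]} ≤ h ≤ γ_{[c,f|_{dom M},M]} pointwise. -/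
namespace EReal

theorem coe_sub_le_comm_s11 {a : ℝ} {u v : EReal} (hu : u ≠ ⊥) (h : (a : EReal) - u ≤ v) :
    (a : EReal) - v ≤ u := by
  induction u with
  | bot => exact absurd rfl hu
  | top => exact le_top
  | coe u =>
    induction v with
    | bot => exact absurd (le_bot_iff.1 h) (EReal.coe_ne_bot (a - u))
    | top => simp
    | coe v => norm_cast at h ⊢; linarith

theorem add_coe_sub_le_iff {a b : ℝ} {u v : EReal} :
    u + ((a - b : ℝ) : EReal) ≤ v ↔ u + (a : EReal) ≤ v + (b : EReal) := by
  rw [EReal.coe_sub, ← add_sub_assoc, EReal.sub_le_iff_le_add (by simp) (by simp)]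

theorem coe_sub_le_coe_sub_of_add_le {a b : ℝ} {u v : EReal}
    (h : u + (a : EReal) ≤ v + (b : EReal)) : (a : EReal) - v ≤ (b : EReal) - u := by
  induction u <;> induction v <;> norm_cast at h ⊢ <;> simp_all
  linarith

theorem coe_sub_coe_sub (a b : ℝ) (u : EReal) :
    (a : EReal) - ((b : EReal) - u) = u + ((a - b : ℝ) : EReal) := by
  induction u <;> norm_cast
  ring

end EReal

section CAntiderivative

variable {X Y : Type*} {c : X → Y → ℝ} {f h : X → EReal} {M : X → Set Y}

/-- The supremum of the `c`-affine minorants of `f` through the points of the graph of `M`. -/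
noncomputable def minorantSup (c : X → Y → ℝ) (f : X → EReal) (M : X → Set Y) : X → EReal :=
  fun x => ⨆ s, ⨆ t ∈ M s, f s + ((c x t - c s t : ℝ) : EReal)

theorem le_minorantSup {s : X} {t : Y} (ht : t ∈ M s) (x : X) :
    f s + ((c x t - c s t : ℝ) : EReal) ≤ minorantSup c f M x :=
  le_iSup_of_le s (le_iSup₂_of_le t ht le_rfl)

theorem IsCAntideriv.minorantSup_le (hh : IsCAntideriv c h M)
    (heq : ∀ s ∈ {x | (M x).Nonempty}, h s = f s) (x : X) : minorantSup c f M x ≤ h x := by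
  refine iSup_le fun s => iSup₂_le fun t ht => ?_
  rw [← heq s ⟨t, ht⟩]
  exact EReal.add_coe_sub_le_iff.2 (hh s t ht x)

theorem isCAntideriv_of_minorantSup_le (hle : ∀ x, minorantSup c f M x ≤ h x)
    (heq : ∀ s ∈ {x | (M x).Nonempty}, h s = f s) : IsCAntideriv c h M := by
  intro s t ht x
  rw [heq s ⟨t, ht⟩]
  exact EReal.add_coe_sub_le_iff.1 ((le_minorantSup ht x).trans (hle x))

theorem IsCAntideriv.minorantSup_eq (hf : IsCAntideriv c f M) {s : X}
    (hs : s ∈ {x | (M x).Nonempty}) : minorantSup c f M s = f s := by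
  refine le_antisymm (hf.minorantSup_le (fun _ _ => rfl) s) ?_
  obtain ⟨t, ht⟩ := hs
  simpa using le_minorantSup (c := c) (f := f) ht s

theorem IsCAntideriv.eProper_minorantSup (hf : IsCAntideriv c f M) (hp : EProper f)
    (hdom : ∃ x, (M x).Nonempty) : EProper (minorantSup c f M) := by
  obtain ⟨s, t, ht⟩ := hdom
  obtain ⟨hbot, a, ha⟩ := hp
  refine ⟨fun x hx => ?_, a, ne_top_of_le_ne_top ha (hf.minorantSup_le (fun _ _ => rfl) a)⟩
  have hle := le_minorantSup (c := c) (f := f) ht x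
  rw [hx, le_bot_iff, EReal.add_eq_bot_iff] at hle
  exact hle.elim (hbot s) (EReal.coe_ne_bot _)

theorem IsCAntideriv.cConvexWith_minorantSup (hf : IsCAntideriv c f M) (hp : EProper f)
    (hdom : ∃ x, (M x).Nonempty) : CConvexWith c (minorantSup c f M) := by
  have hF := hf.eProper_minorantSup hp hdom
  have key : ∀ x t, (c x t : EReal) - minorantSup c f M x
      ≤ ⨅ s, ⨅ _ : t ∈ M s, (c s t : EReal) - f s := by
    refine fun x t => le_iInf fun s => le_iInf fun ht => ?_
    have hx := EReal.add_coe_sub_le_iff.1 (le_minorantSup (c := c) (f := f) ht x)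
    exact EReal.coe_sub_le_coe_sub_of_add_le hx
  refine ⟨hF, fun t => ⨅ s, ⨅ _ : t ∈ M s, (c s t : EReal) - f s, fun t => ?_, ?_⟩
  · obtain ⟨a, ha⟩ := hF.2
    refine ne_bot_of_le_ne_bot ?_ (key a t)
    lift minorantSup c f M a to ℝ using ⟨ha, hF.1 a⟩ with r
    exact EReal.coe_ne_bot (c a t - r)
  · funext x
    refine le_antisymm (iSup_le fun s => iSup₂_le fun t ht => ?_)
      (iSup_le fun t => EReal.coe_sub_le_comm_s11 (hF.1 x) (key x t))
    refine le_iSup_of_le t (le_trans ?_ (EReal.sub_le_sub le_rfl (iInf₂_le s ht)))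
    exact (EReal.coe_sub_coe_sub _ _ _).ge

theorem IsCAntideriv.minorantSup_mem_aFam (hf : IsCAntideriv c f M) (hp : EProper f)
    (hdom : ∃ x, (M x).Nonempty) : minorantSup c f M ∈ AFam c f {x | (M x).Nonempty} M :=
  ⟨hf.cConvexWith_minorantSup hp hdom,
    isCAntideriv_of_minorantSup_le (fun _ => le_rfl) fun _ => hf.minorantSup_eq,
    fun _ => hf.minorantSup_eq⟩

theorem IsCAntideriv.iInf_aFam_eq (hf : IsCAntideriv c f M) (hp : EProper f)
    (hdom : ∃ x, (M x).Nonempty) (x : X) :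
    ⨅ h ∈ AFam c f {x | (M x).Nonempty} M, h x = minorantSup c f M x :=
  le_antisymm (iInf₂_le _ (hf.minorantSup_mem_aFam hp hdom))
    (le_iInf₂ fun _ hh => hh.2.1.minorantSup_le hh.2.2 x)

end CAntiderivative

/-- with `S = dom M`, the lower envelope satisfies
`α_{[c,f|_{dom M},M]}(x) = sup_{(s,t) ∈ G(M)} [f(s) + c(x,t) − c(s,t)]`, and a `c`-convex `h`
belongs to `𝒜_{[c,f|_{dom M},M]}` iff `α ≤ h ≤ γ` pointwise. -/
theorem lowerEnvelope_formula_of_domEq {X Y : Type*} [Nonempty X] [Nonempty Y]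
    (c : X → Y → ℝ) (f : X → EReal) (hf : EProper f) (M : X → Set Y)
    (hanti : IsCAntideriv c f M) (hdom : ∃ x, (M x).Nonempty) :
    (∀ x, (⨅ h ∈ AFam c f {x | (M x).Nonempty} M, h x) =
      ⨆ s, ⨆ t ∈ M s, f s + ((c x t - c s t : ℝ) : EReal)) ∧
    (∀ h : X → EReal, CConvexWith c h →
      (h ∈ AFam c f {x | (M x).Nonempty} M ↔
        ∀ x, (⨅ h' ∈ AFam c f {x | (M x).Nonempty} M, h' x) ≤ h x ∧
          h x ≤ ⨆ h' ∈ AFam c f {x | (M x).Nonempty} M, h' x)) := by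
  have hα := hanti.iInf_aFam_eq hf hdom
  refine ⟨hα, fun h hc => ⟨fun hh x => ⟨iInf₂_le h hh, le_iSup₂_of_le h hh le_rfl⟩, fun hb => ?_⟩⟩
  have hle : ∀ x, minorantSup c f M x ≤ h x := fun x => (hα x).symm.trans_le (hb x).1
  have heq : ∀ s ∈ {x | (M x).Nonempty}, h s = f s := fun s hs =>
    le_antisymm ((hb s).2.trans (iSup₂_le fun _ hh => (hh.2.2 s hs).le))
      ((hanti.minorantSup_eq hs).symm.trans_le (hle s))
  exact ⟨hc, isCAntideriv_of_minorantSup_le hle heq, heq⟩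
end

section
/- A proper mapping M : X ⇉ Y is c-cyclically monotone if and only if it has a proper c-antiderivative. Moreover, for any s ∈ dom M, Rockafellar's function R_{[c,M,s]} is proper if and only if M is proper and c-cyclically monotone, and in this case R_{[c,M,s]} is a proper c-convex c-antiderivative of M satisfying R_{[c,M,s]}(s) = 0. -/
/-- `M` is `c`-cyclically monotone: every finite cycle in `G(M)` has nonnegative sum
`Σ [c(x_i,y_i) − c(x_{i+1},y_i)]` (indices cyclic). -/
def CCyclicMonotone {A B : Type*} (k : A → B → ℝ) (M : A → Set B) : Prop :=
  ∀ (n : ℕ) (x : Fin (n + 1) → A) (y : Fin (n + 1) → B),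
    (∀ i, y i ∈ M (x i)) →
    0 ≤ ∑ i : Fin (n + 1), (k (x i) (y i) - k (x (i + 1)) (y i))

/-- Rockafellar's function `R_{[c,M,s]}(x)`: the supremum over all chains
`(x_1,y_1),…,(x_n,y_n) ∈ G(M)` with `x_1 = s` of
`Σ_{i=1}^n [c(x_{i+1},y_i) − c(x_i,y_i)]`, where `x_{n+1} := x`. -/
noncomputable def Rockafellar {A B : Type*} (k : A → B → ℝ) (M : A → Set B) (s : A) :
    A → EReal :=
  fun x => ⨆ (n : ℕ) (xs : Fin (n + 1) → A) (ys : Fin (n + 1) → B)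
      (_ : xs 0 = s) (_ : ∀ i, ys i ∈ M (xs i)),
    (((∑ i : Fin n, (k (xs i.succ) (ys i.castSucc) - k (xs i.castSucc) (ys i.castSucc))) +
      (k x (ys (Fin.last n)) - k (xs (Fin.last n)) (ys (Fin.last n))) : ℝ) : EReal)

section Rockafellar

variable {A B : Type*} {k : A → B → ℝ} {M : A → Set B} {s : A}

/-- The part of the value of a Rockafellar chain that does not depend on the evaluation point. -/
def chainConst {n : ℕ} (k : A → B → ℝ) (xs : Fin (n + 1) → A) (ys : Fin (n + 1) → B) : ℝ :=
  (∑ i : Fin n, (k (xs i.succ) (ys i.castSucc) - k (xs i.castSucc) (ys i.castSucc))) -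
    k (xs (Fin.last n)) (ys (Fin.last n))

theorem chainConst_snoc {n : ℕ} (xs : Fin (n + 1) → A) (ys : Fin (n + 1) → B) (x : A) (y : B) :
    chainConst k (Fin.snoc xs x : Fin (n + 2) → A) (Fin.snoc ys y : Fin (n + 2) → B) =
      chainConst k xs ys + k x (ys (Fin.last n)) - k x y := by
  simp only [chainConst, Fin.sum_univ_castSucc, Fin.snoc_castSucc, ← Fin.castSucc_succ,
    Fin.succ_last, Fin.snoc_last]
  ring

theorem chain_le_rockafellar {n : ℕ} {xs : Fin (n + 1) → A} {ys : Fin (n + 1) → B}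
    (h0 : xs 0 = s) (hM : ∀ i, ys i ∈ M (xs i)) (x : A) :
    ((chainConst k xs ys + k x (ys (Fin.last n)) : ℝ) : EReal) ≤ Rockafellar k M s x := by
  refine le_trans (le_of_eq ?_) (le_iSup_of_le n <| le_iSup_of_le xs <| le_iSup_of_le ys <|
    le_iSup_of_le h0 <| le_iSup_of_le hM le_rfl)
  rw [chainConst]
  congr 1
  ring

theorem rockafellar_le {x : A} {z : EReal}
    (h : ∀ (n : ℕ) (xs : Fin (n + 1) → A) (ys : Fin (n + 1) → B), xs 0 = s →
      (∀ i, ys i ∈ M (xs i)) →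
      ((chainConst k xs ys + k x (ys (Fin.last n)) : ℝ) : EReal) ≤ z) :
    Rockafellar k M s x ≤ z := by
  refine iSup_le fun n => iSup_le fun xs => iSup_le fun ys => iSup_le fun h0 => iSup_le fun hM =>
    le_trans (le_of_eq ?_) (h n xs ys h0 hM)
  rw [chainConst]
  congr 1
  ring

theorem isCAntideriv_rockafellar : IsCAntideriv k (Rockafellar k M s) M := by
  intro x y hy x'
  rw [← EReal.le_sub_iff_add_le (by simp) (by simp)]
  refine rockafellar_le fun n xs ys h0 hM => ?_
  rw [EReal.le_sub_iff_add_le (by simp) (by simp),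
    ← EReal.sub_le_iff_le_add (by simp) (by simp)]
  have h := chain_le_rockafellar (k := k) (M := M) (s := s)
    (xs := (Fin.snoc xs x : Fin (n + 2) → A)) (ys := (Fin.snoc ys y : Fin (n + 2) → B))
    (by rw [← Fin.castSucc_zero, Fin.snoc_castSucc, h0])
    (fun i => by
      refine Fin.lastCases ?_ (fun j => ?_) i
      · simpa only [Fin.snoc_last] using hy
      · simpa only [Fin.snoc_castSucc] using hM j) x'
  rw [chainConst_snoc, Fin.snoc_last] at h
  norm_cast
  convert h using 2
  ring

theorem rockafellar_ne_bot (hs : (M s).Nonempty) (x : A) : Rockafellar k M s x ≠ ⊥ := by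
  obtain ⟨y, hy⟩ := hs
  exact ne_bot_of_le_ne_bot (EReal.coe_ne_bot _)
    (chain_le_rockafellar (n := 0) (xs := fun _ => s) (ys := fun _ => y) rfl (fun _ => hy) x)

theorem rockafellar_self (hk : CCyclicMonotone k M) (hs : (M s).Nonempty) :
    Rockafellar k M s s = 0 := by
  apply le_antisymm
  · refine rockafellar_le fun n xs ys h0 hM => ?_
    have h := hk n xs ys hM
    rw [Fin.sum_univ_castSucc] at h
    simp only [Fin.coeSucc_eq_succ, Fin.last_add_one, h0] at h
    have hneg : (∑ i : Fin n,
        (k (xs i.succ) (ys i.castSucc) - k (xs i.castSucc) (ys i.castSucc))) =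
        -∑ i : Fin n, (k (xs i.castSucc) (ys i.castSucc) - k (xs i.succ) (ys i.castSucc)) := by
      simp
    rw [chainConst, hneg]
    exact_mod_cast (by linarith)
  · obtain ⟨y, hy⟩ := hs
    have h := chain_le_rockafellar (k := k) (n := 0) (xs := fun _ => s) (ys := fun _ => y)
      rfl (fun _ => hy) s
    simpa [chainConst] using h

theorem eProper_rockafellar (hk : CCyclicMonotone k M) (hs : (M s).Nonempty) :
    EProper (Rockafellar k M s) :=
  ⟨rockafellar_ne_bot hs, s, by simp [rockafellar_self hk hs]⟩

theorem cConvexWith_rockafellar (h : EProper (Rockafellar k M s)) :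
    CConvexWith k (Rockafellar k M s) := by
  refine ⟨h, cTransform k (Rockafellar k M s), fun y => ?_, funext fun x => le_antisymm ?_ ?_⟩
  · obtain ⟨hbot, a, ha⟩ := h
    refine ne_bot_of_le_ne_bot ?_ (le_iSup (fun a => (k a y : EReal) - Rockafellar k M s a) a)
    lift Rockafellar k M s a to ℝ using ⟨ha, hbot a⟩ with r
    exact EReal.coe_ne_bot (k a y - r)
  · refine rockafellar_le fun n xs ys h0 hM => ?_
    refine le_iSup_of_le (ys (Fin.last n)) ?_
    have hg : cTransform k (Rockafellar k M s) (ys (Fin.last n)) ≤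
        ((-chainConst k xs ys : ℝ) : EReal) := by
      refine iSup_le fun x' => ?_
      refine (EReal.sub_le_sub le_rfl (chain_le_rockafellar h0 hM x')).trans (le_of_eq ?_)
      norm_cast
      ring
    refine le_trans (le_of_eq ?_) (EReal.sub_le_sub le_rfl hg)
    norm_cast
    ring
  · refine iSup_le fun y => ?_
    have hg : (k x y : EReal) - Rockafellar k M s x ≤ cTransform k (Rockafellar k M s) y :=
      le_iSup (fun a => (k a y : EReal) - Rockafellar k M s a) x
    refine (EReal.sub_le_sub le_rfl hg).trans ?_
    have hb := h.1 x
    generalize Rockafellar k M s x = v at hb ⊢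
    induction v with
    | bot => exact absurd rfl hb
    | top => exact le_top
    | coe r =>
      norm_cast
      linarith

end Rockafellar

theorem cCyclicMonotone_of_isCAntideriv {A B : Type*} {k : A → B → ℝ} {M : A → Set B}
    {f : A → EReal} (hf : EProper f) (h : IsCAntideriv k f M) : CCyclicMonotone k M := by
  intro n x y hM
  obtain ⟨hbot, a, ha⟩ := hf
  have hfin : ∀ i, f (x i) ≠ ⊤ := by
    intro i hi
    have hle := h _ _ (hM i) a
    rw [hi, EReal.top_add_coe, top_le_iff] at hle
    lift f a to ℝ using ⟨ha, hbot a⟩ with r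
    exact EReal.coe_ne_top (r + k (x i) (y i)) hle
  have hreal : ∀ i, ((f (x i)).toReal : EReal) = f (x i) := fun i =>
    EReal.coe_toReal (hfin i) (hbot _)
  have hstep : ∀ i, (f (x i)).toReal - (f (x (i + 1))).toReal ≤
      k (x i) (y i) - k (x (i + 1)) (y i) := by
    intro i
    have hle := h _ _ (hM i) (x (i + 1))
    rw [← hreal i, ← hreal (i + 1)] at hle
    norm_cast at hle
    linarith
  have hsum : ∑ i, ((f (x i)).toReal - (f (x (i + 1))).toReal) = 0 := by
    rw [Finset.sum_sub_distrib, sub_eq_zero]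
    exact (Equiv.sum_comp (Equiv.addRight 1) fun i => (f (x i)).toReal).symm
  exact hsum.symm.le.trans (Finset.sum_le_sum fun i _ => hstep i)

/-- a proper mapping `M` is `c`-cyclically monotone iff it has a proper
`c`-antiderivative; moreover, for `s ∈ dom M`, `R_{[c,M,s]}` is proper iff `M` is
`c`-cyclically monotone, in which case `R_{[c,M,s]}` is a proper `c`-convex
`c`-antiderivative of `M` with `R_{[c,M,s]}(s) = 0`. -/
theorem rockafellar_characterization {X Y : Type*} [Nonempty X] [Nonempty Y]
    (c : X → Y → ℝ) (M : X → Set Y) (hM : ∃ x, (M x).Nonempty) :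
    (CCyclicMonotone c M ↔ ∃ f : X → EReal, EProper f ∧ IsCAntideriv c f M) ∧
    (∀ s : X, (M s).Nonempty →
      (EProper (Rockafellar c M s) ↔ CCyclicMonotone c M) ∧
      (CCyclicMonotone c M →
        EProper (Rockafellar c M s) ∧ CConvexWith c (Rockafellar c M s) ∧
        IsCAntideriv c (Rockafellar c M s) M ∧ Rockafellar c M s s = 0)) := by
  refine ⟨⟨fun hc => ?_, fun ⟨f, hf, h⟩ => cCyclicMonotone_of_isCAntideriv hf h⟩,
    fun s hs => ⟨⟨fun hR => cCyclicMonotone_of_isCAntideriv hR isCAntideriv_rockafellar,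
      fun hc => eProper_rockafellar hc hs⟩, fun hc => ?_⟩⟩
  · obtain ⟨s, hs⟩ := hM
    exact ⟨Rockafellar c M s, eProper_rockafellar hc hs, isCAntideriv_rockafellar⟩
  · have hR := eProper_rockafellar hc hs
    exact ⟨hR, cConvexWith_rockafellar hR, isCAntideriv_rockafellar, rockafellar_self hc hs⟩
end

section
/- Suppose that the proper function f : X → (−∞,+∞] is a c-antiderivative of the mapping M : X ⇉ Y and that ∅ ≠ S ⊆ dom M. Then the minimal c-convex c-antiderivative of M agreeing with f on S is given by α_{[c,f|_S,M]}(x) = sup_{s∈S} [f(s) + R_{[c,M,s]}(x)] for all x ∈ X; this function belongs to 𝒜_{[c,f|_S,M]} and minorizes every h ∈ 𝒜_{[c,f|_S,M]}. -/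
theorem EReal.add_coe_le_add_coe_iff (u v : EReal) (p q : ℝ) :
    u + (p : EReal) ≤ v + (q : EReal) ↔ u + ((p - q : ℝ) : EReal) ≤ v := by
  induction u <;> induction v <;> simp [-EReal.coe_sub, ← EReal.coe_add]
  constructor <;> intro h <;> linarith

/-- The value at `x` of the chain `(xs 0, ys 0), …, (xs n, ys n)` in Rockafellar's function. -/
def chainSum {A B : Type*} (k : A → B → ℝ) {n : ℕ} (xs : Fin (n + 1) → A)
    (ys : Fin (n + 1) → B) (x : A) : ℝ :=
  (∑ i : Fin n, (k (xs i.succ) (ys i.castSucc) - k (xs i.castSucc) (ys i.castSucc))) +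
    (k x (ys (Fin.last n)) - k (xs (Fin.last n)) (ys (Fin.last n)))

section Chain

variable {A B : Type*} {k : A → B → ℝ} {M : A → Set B}

theorem chainSum_succ {n : ℕ} (xs : Fin (n + 2) → A) (ys : Fin (n + 2) → B) (x : A) :
    chainSum k xs ys x =
      chainSum k (fun i => xs i.castSucc) (fun i => ys i.castSucc) (xs (Fin.last _)) +
        (k x (ys (Fin.last _)) - k (xs (Fin.last _)) (ys (Fin.last _))) := by
  simp [chainSum, Fin.sum_univ_castSucc]
  ring

theorem mem_cSubdiff_iff {h : A → EReal} {a : A} {b : B} :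
    b ∈ cSubdiff k h a ↔ ∀ a', h a + ((k a' b - k a b : ℝ) : EReal) ≤ h a' :=
  forall_congr' fun _ => EReal.add_coe_le_add_coe_iff _ _ _ _

theorem IsCAntideriv.add_chainSum_le {h : A → EReal} (hh : IsCAntideriv k h M) {n : ℕ}
    (xs : Fin (n + 1) → A) (ys : Fin (n + 1) → B) (hM : ∀ i, ys i ∈ M (xs i)) (x : A) :
    h (xs 0) + (chainSum k xs ys x : EReal) ≤ h x := by
  induction n generalizing x with
  | zero => simpa [chainSum] using mem_cSubdiff_iff.1 (hh _ _ (hM 0)) x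
  | succ n ih =>
    rw [chainSum_succ, EReal.coe_add, ← add_assoc]
    exact (add_le_add_left (ih (fun i => xs i.castSucc) (fun i => ys i.castSucc)
      (fun i => hM i.castSucc) _) _).trans (mem_cSubdiff_iff.1 (hh _ _ (hM (Fin.last _))) x)

theorem chainSum_le_rockafellar {n : ℕ} (xs : Fin (n + 1) → A) (ys : Fin (n + 1) → B)
    (hM : ∀ i, ys i ∈ M (xs i)) (x : A) :
    (chainSum k xs ys x : EReal) ≤ Rockafellar k M (xs 0) x :=
  le_iSup_of_le n <| le_iSup_of_le xs <| le_iSup_of_le ys <| le_iSup_of_le rfl <|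
    le_iSup_of_le hM le_rfl

theorem coe_sub_le_rockafellar {s : A} {b : B} (hb : b ∈ M s) (x : A) :
    ((k x b - k s b : ℝ) : EReal) ≤ Rockafellar k M s x := by
  simpa [chainSum] using
    chainSum_le_rockafellar (k := k) (n := 0) (fun _ => s) (fun _ => b) (fun _ => hb) x

theorem add_rockafellar_le {s x : A} {u : EReal} {v : EReal} (hbot : u ≠ ⊥) (htop : u ≠ ⊤)
    (H : ∀ (n : ℕ) (xs : Fin (n + 1) → A) (ys : Fin (n + 1) → B), xs 0 = s →
      (∀ i, ys i ∈ M (xs i)) → u + (chainSum k xs ys x : EReal) ≤ v) :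
    u + Rockafellar k M s x ≤ v := by
  lift u to ℝ using ⟨htop, hbot⟩
  have key : Rockafellar k M s x ≤ v - u := by
    refine iSup_le fun n => iSup_le fun xs => iSup_le fun ys => iSup_le fun h0 =>
      iSup_le fun hM => ?_
    rw [EReal.le_sub_iff_add_le (by simp) (by simp), add_comm]
    exact H n xs ys h0 hM
  rwa [EReal.le_sub_iff_add_le (by simp) (by simp), add_comm] at key

theorem chainSum_add_le_rockafellar {n : ℕ} (xs : Fin (n + 1) → A) (ys : Fin (n + 1) → B)
    (hM : ∀ i, ys i ∈ M (xs i)) {a : A} {b : B} (hb : b ∈ M a) (x : A) :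
    ((chainSum k xs ys a + (k x b - k a b) : ℝ) : EReal) ≤ Rockafellar k M (xs 0) x := by
  have h := chainSum_le_rockafellar (k := k) (M := M) (Fin.snoc (α := fun _ => A) xs a)
    (Fin.snoc (α := fun _ => B) ys b)
    (fun i => by
      refine Fin.lastCases ?_ (fun i => ?_) i
      · simpa using hb
      · simpa using hM i) x
  rw [chainSum_succ] at h
  have h0 : (Fin.snoc (α := fun _ => A) xs a : Fin (n + 2) → A) 0 = xs 0 :=
    Fin.snoc_castSucc (α := fun _ => A) a xs 0
  simpa only [h0, Fin.snoc_castSucc, Fin.snoc_last] using h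

theorem IsCAntideriv.ne_top {h : A → EReal} (hh : IsCAntideriv k h M) (hp : EProper h)
    {a : A} (ha : (M a).Nonempty) : h a ≠ ⊤ := by
  obtain ⟨b, hb⟩ := ha
  obtain ⟨a', ha'⟩ := hp.2
  intro htop
  have := mem_cSubdiff_iff.1 (hh a b hb) a'
  rw [htop, EReal.top_add_coe] at this
  exact ha' (top_le_iff.1 this)

/-- A proper function which is, at each point, at most every upper bound of its `c`-affine
minorants is `c`-convex. -/
theorem cConvexWith_of_minorants {F : A → EReal} (hF : EProper F)
    (H : ∀ x v, (∀ (b : B) (r : ℝ), (∀ a, ((k a b + r : ℝ) : EReal) ≤ F a) →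
      ((k x b + r : ℝ) : EReal) ≤ v) → F x ≤ v) : CConvexWith k F := by
  refine ⟨hF, cTransform k F, fun b hb => ?_, funext fun x => le_antisymm ?_ ?_⟩
  · obtain ⟨a, ha⟩ := hF.2
    have h1 : (k a b : EReal) - F a ≤ ⊥ := by
      rw [← hb]
      exact le_iSup (fun a => (k a b : EReal) - F a) a
    have h2 := hF.1 a
    generalize F a = u at ha h1 h2
    lift u to ℝ using ⟨ha, h2⟩
    rw [← EReal.coe_sub] at h1
    exact EReal.coe_ne_bot _ (le_bot_iff.1 h1)
  · refine H x _ fun b r hr => le_iSup_of_le b ?_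
    have h1 : cTransform k F b ≤ ((-r : ℝ) : EReal) := by
      refine iSup_le fun a => ?_
      have := hr a
      generalize F a = u at this
      induction u with
      | bot => exact absurd (le_bot_iff.1 this) (EReal.coe_ne_bot _)
      | top => simp
      | coe u =>
        norm_cast at this ⊢
        linarith
    refine le_trans ?_ (EReal.sub_le_sub le_rfl h1)
    norm_cast
    simp
  · refine iSup_le fun b => ?_
    have h1 : (k x b : EReal) - F x ≤ cTransform k F b :=
      le_iSup (fun a => (k a b : EReal) - F a) x
    have h2 := hF.1 x
    generalize F x = u at h1 h2
    generalize cTransform k F b = w at h1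
    induction u with
    | bot => exact absurd rfl h2
    | top => simp
    | coe u =>
      induction w with
      | bot => exact absurd (le_bot_iff.1 h1) (by rw [← EReal.coe_sub]; exact EReal.coe_ne_bot _)
      | top => simp
      | coe w =>
        norm_cast at h1 ⊢
        linarith

theorem IsCAntideriv.iSup_add_rockafellar_le {f h : A → EReal} {S : Set A}
    (hh : IsCAntideriv k h M) (hfh : ∀ s ∈ S, h s = f s)
    (hbot : ∀ s ∈ S, f s ≠ ⊥) (htop : ∀ s ∈ S, f s ≠ ⊤) (x : A) :
    (⨆ s ∈ S, f s + Rockafellar k M s x) ≤ h x := by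
  refine iSup₂_le fun s hs => add_rockafellar_le (hbot s hs) (htop s hs) ?_
  rintro n xs ys rfl hM
  rw [← hfh _ hs]
  exact hh.add_chainSum_le xs ys hM x

theorem iSup_add_rockafellar_le {f : A → EReal} {S : Set A}
    (hbot : ∀ s ∈ S, f s ≠ ⊥) (htop : ∀ s ∈ S, f s ≠ ⊤) {x : A} {v : EReal}
    (H : ∀ (n : ℕ) (xs : Fin (n + 1) → A) (ys : Fin (n + 1) → B), xs 0 ∈ S →
      (∀ i, ys i ∈ M (xs i)) → f (xs 0) + (chainSum k xs ys x : EReal) ≤ v) :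
    (⨆ s ∈ S, f s + Rockafellar k M s x) ≤ v := by
  refine iSup₂_le fun s hs => add_rockafellar_le (hbot s hs) (htop s hs) ?_
  rintro n xs ys rfl hM
  exact H n xs ys hs hM

theorem isCAntideriv_iSup_add_rockafellar {f : A → EReal} {S : Set A}
    (hbot : ∀ s ∈ S, f s ≠ ⊥) (htop : ∀ s ∈ S, f s ≠ ⊤) :
    IsCAntideriv k (fun x => ⨆ s ∈ S, f s + Rockafellar k M s x) M := by
  intro a b hb
  rw [mem_cSubdiff_iff]
  intro a'
  rw [← EReal.le_sub_iff_add_le (.inl (EReal.coe_ne_bot _)) (.inl (EReal.coe_ne_top _))]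
  refine iSup_add_rockafellar_le hbot htop fun n xs ys hs hM => ?_
  rw [EReal.le_sub_iff_add_le (.inl (EReal.coe_ne_bot _)) (.inl (EReal.coe_ne_top _)), add_assoc,
    ← EReal.coe_add]
  exact le_iSup₂_of_le (xs 0) hs (add_le_add_right (chainSum_add_le_rockafellar xs ys hM hb a') _)

theorem iSup_add_rockafellar_mem_aFam {f : A → EReal} (hf : EProper f)
    (hanti : IsCAntideriv k f M) {S : Set A} (hS : S.Nonempty)
    (hSdom : ∀ s ∈ S, (M s).Nonempty) :
    (fun x => ⨆ s ∈ S, f s + Rockafellar k M s x) ∈ AFam k f S M := by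
  have hbot : ∀ s ∈ S, f s ≠ ⊥ := fun s _ => hf.1 s
  have htop : ∀ s ∈ S, f s ≠ ⊤ := fun s hs => hanti.ne_top hf (hSdom s hs)
  have heq : ∀ s ∈ S, (⨆ t ∈ S, f t + Rockafellar k M t s) = f s := by
    intro s hs
    refine le_antisymm (hanti.iSup_add_rockafellar_le (fun _ _ => rfl) hbot htop s) ?_
    obtain ⟨b, hb⟩ := hSdom s hs
    refine le_iSup₂_of_le s hs (le_add_of_nonneg_right ?_)
    simpa using coe_sub_le_rockafellar (k := k) hb s
  obtain ⟨s, hs⟩ := hS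
  have hproper : EProper (fun x => ⨆ t ∈ S, f t + Rockafellar k M t x) := by
    refine ⟨fun x hx => ?_, s, (heq s hs).trans_ne (htop s hs)⟩
    obtain ⟨b, hb⟩ := hSdom s hs
    have h1 : f s + Rockafellar k M s x = ⊥ :=
      le_bot_iff.1 (hx ▸ le_iSup₂ (f := fun t _ => f t + Rockafellar k M t x) s hs)
    rcases EReal.add_eq_bot_iff.1 h1 with h | h
    · exact hbot s hs h
    · have h2 := coe_sub_le_rockafellar (k := k) hb x
      rw [h] at h2
      exact EReal.coe_ne_bot _ (le_bot_iff.1 h2)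
  refine ⟨cConvexWith_of_minorants hproper fun x v H => ?_,
    isCAntideriv_iSup_add_rockafellar hbot htop, heq⟩
  refine iSup_add_rockafellar_le hbot htop fun n xs ys hs hM => ?_
  obtain ⟨u, hu⟩ : ∃ u : ℝ, (u : EReal) = f (xs 0) :=
    ⟨_, EReal.coe_toReal (htop _ hs) (hbot _ hs)⟩
  have hval : ∀ a, f (xs 0) + (chainSum k xs ys a : EReal) =
      ((k a (ys (Fin.last n)) + (u + chainSum k xs ys x - k x (ys (Fin.last n))) : ℝ) :
        EReal) := by
    intro a
    rw [← hu, ← EReal.coe_add]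
    congr 1
    simp only [chainSum]
    ring
  rw [hval]
  refine H _ _ fun a => ?_
  rw [← hval]
  exact le_iSup₂_of_le (xs 0) hs (add_le_add_right (chainSum_le_rockafellar xs ys hM a) _)

end Chain

/-- the minimal `c`-convex `c`-antiderivative of `M` agreeing with `f` on `S`
is `α_{[c,f|_S,M]}(x) = sup_{s∈S} [f(s) + R_{[c,M,s]}(x)]`; this function belongs to
`𝒜_{[c,f|_S,M]}` and minorizes every member of `𝒜_{[c,f|_S,M]}`. -/
theorem lowerEnvelope_eq_sup_rockafellar {X Y : Type*} [Nonempty X] [Nonempty Y]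
    (c : X → Y → ℝ) (f : X → EReal) (hf : EProper f) (M : X → Set Y)
    (hanti : IsCAntideriv c f M) (S : Set X) (hS : S.Nonempty)
    (hSdom : ∀ s ∈ S, (M s).Nonempty) :
    (∀ x, (⨅ h ∈ AFam c f S M, h x) = ⨆ s ∈ S, f s + Rockafellar c M s x) ∧
    (fun x => ⨆ s ∈ S, f s + Rockafellar c M s x) ∈ AFam c f S M ∧
    (∀ h ∈ AFam c f S M, ∀ x, (⨆ s ∈ S, f s + Rockafellar c M s x) ≤ h x) := by
  have hbot : ∀ s ∈ S, f s ≠ ⊥ := fun s _ => hf.1 s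
  have htop : ∀ s ∈ S, f s ≠ ⊤ := fun s hs => hanti.ne_top hf (hSdom s hs)
  have hmem := iSup_add_rockafellar_mem_aFam hf hanti hS hSdom
  have hle : ∀ h ∈ AFam c f S M, ∀ x, (⨆ s ∈ S, f s + Rockafellar c M s x) ≤ h x :=
    fun h hh x => hh.2.1.iSup_add_rockafellar_le hh.2.2 hbot htop x
  exact ⟨fun x => le_antisymm (iInf₂_le_of_le _ hmem le_rfl) (le_iInf₂ fun h hh => hle h hh x),
    hmem, hle⟩
end

section
/- Let (X,d) be a metric space and take Y = X with coupling function c = −d. For any proper function f : X → (−∞,+∞], the following assertions are equivalent: (1) f is real-valued and 1-Lipschitz (|f(x)−f(y)| ≤ d(x,y) for all x,y); (2) f^{−d} = −f (in particular f is real-valued); (3) f is −d-convex; (4) f is a −d-antiderivative of the identity mapping I : X → X, i.e. x ∈ ∂_{−d} f(x) for every x ∈ X. In this case f is real-valued and G(∂_{−d} f) = {(x,y) ∈ X × X | f(y) − f(x) = d(x,y)}. -/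
section NegDist

variable {X : Type*} [MetricSpace X]

/-- The `(-d)`-transform of a real-valued `1`-Lipschitz function `g` is `-g`. -/
theorem cTransform_negDist_of_lipschitz {g : X → ℝ} (hg : ∀ x y, |g x - g y| ≤ dist x y) :
    cTransform (fun x y : X => -dist x y) (fun x => (g x : EReal)) = fun y => -(g y : EReal) := by
  funext y
  apply le_antisymm
  · refine iSup_le fun a => ?_
    dsimp only
    norm_cast
    linarith [(abs_le.1 (hg a y)).1]
  · refine le_iSup_of_le y ?_
    simp

/-- The diagonal belongs to the graph of the `(-d)`-subdifferential of `f` if and only if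
`f x ≤ f x' + d(x, x')` for all `x, x'`. -/
theorem forall_mem_cSubdiff_negDist_self_iff {f : X → EReal} :
    (∀ x, x ∈ cSubdiff (fun x y : X => -dist x y) f x) ↔
      ∀ x x', f x ≤ f x' + (dist x x' : EReal) := by
  refine forall_congr' fun x => forall_congr' fun x' => ?_
  simp only [dist_self, neg_zero, EReal.coe_zero, add_zero]
  rw [dist_comm x' x, EReal.coe_neg, ← sub_eq_add_neg,
    EReal.sub_le_iff_le_add (by simp) (by simp)]

/-- A proper function with `f x ≤ f x' + d(x, x')` is real-valued and `1`-Lipschitz. -/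
theorem EProper.exists_lipschitz {f : X → EReal} (hf : EProper f)
    (h : ∀ x x', f x ≤ f x' + (dist x x' : EReal)) :
    ∃ g : X → ℝ, (∀ x, f x = (g x : EReal)) ∧ ∀ x y, |g x - g y| ≤ dist x y := by
  obtain ⟨hbot, a, ha⟩ := hf
  have htop : ∀ x, f x ≠ ⊤ := fun x =>
    ne_top_of_le_ne_top (EReal.add_ne_top ha (EReal.coe_ne_top _)) (h x a)
  lift f to X → ℝ using fun x => ⟨htop x, hbot x⟩
  refine ⟨f, fun _ => rfl, fun x y => ?_⟩
  have hxy := h x y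
  have hyx := h y x
  dsimp only at hxy hyx
  norm_cast at hxy hyx
  rw [dist_comm y x] at hyx
  exact abs_sub_le_iff.2 ⟨by linarith, by linarith⟩

theorem le_add_dist_of_cTransform_negDist_eq_neg {f : X → EReal}
    (h : cTransform (fun x y : X => -dist x y) f = fun y => -f y) (x x' : X) :
    f x ≤ f x' + (dist x x' : EReal) := by
  have hle : ((-dist x' x : ℝ) : EReal) - f x' ≤ -f x := by
    have hx := congrFun h x
    rw [← hx]
    exact le_iSup (fun a => ((-dist a x : ℝ) : EReal) - f a) x'
  rw [dist_comm x' x] at hle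
  have hneg := EReal.neg_le_neg_iff.2 hle
  rwa [neg_neg, EReal.neg_sub (by simp) (by simp), EReal.coe_neg, neg_neg, add_comm] at hneg

theorem CConvexWith.le_add_dist {f : X → EReal}
    (h : CConvexWith (fun x y : X => -dist x y) f) (x x' : X) :
    f x ≤ f x' + (dist x x' : EReal) := by
  obtain ⟨-, g, hg, rfl⟩ := h
  refine iSup_le fun b => ?_
  refine le_trans ?_ (add_le_add_left
    (le_iSup (fun b => ((-dist x' b : ℝ) : EReal) - g b) b) _)
  have hb := hg b
  induction hgb : g b with
  | bot => exact absurd hgb hb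
  | top => simp
  | coe r =>
    norm_cast
    linarith [dist_triangle x' x b, dist_comm x x']

theorem cConvexWith_negDist_of_lipschitz [Nonempty X] {g : X → ℝ}
    (hg : ∀ x y, |g x - g y| ≤ dist x y) :
    CConvexWith (fun x y : X => -dist x y) (fun x => (g x : EReal)) := by
  refine ⟨⟨fun _ => EReal.coe_ne_bot _, Classical.arbitrary X, EReal.coe_ne_top _⟩,
    fun x => ((-g x : ℝ) : EReal), fun _ => EReal.coe_ne_bot _, ?_⟩
  have h := cTransform_negDist_of_lipschitz (g := fun x => -g x) fun x y => by
    rw [neg_sub_neg, abs_sub_comm]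
    exact hg x y
  simp only [dist_comm] at h ⊢
  rw [h]
  simp

theorem mem_cSubdiff_negDist_iff_of_lipschitz {g : X → ℝ}
    (hg : ∀ x y, |g x - g y| ≤ dist x y) (x y : X) :
    y ∈ cSubdiff (fun x y : X => -dist x y) (fun x => (g x : EReal)) x ↔
      (g y : EReal) - g x = (dist x y : EReal) := by
  simp only [cSubdiff, Set.mem_ofPred_eq]
  norm_cast
  constructor
  · intro h
    have hy := h y
    rw [dist_self] at hy
    linarith [(abs_le.1 (hg x y)).1]
  · intro h a
    linarith [(abs_le.1 (hg a y)).1]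

end NegDist

/-- on a metric space with coupling `c = −d`, for a proper `f : X → (−∞,+∞]`
the following are equivalent: `f` is real-valued and `1`-Lipschitz; `f^{−d} = −f`;
`f` is `−d`-convex; `f` is a `−d`-antiderivative of the identity. In this case `f` is
real-valued and `G(∂_{−d} f) = {(x,y) | f(y) − f(x) = d(x,y)}`. -/
theorem lipschitz_eq_negDistConvex {X : Type*} [MetricSpace X] [Nonempty X]
    (f : X → EReal) (hf : EProper f) :
    ((∃ g : X → ℝ, (∀ x, f x = (g x : EReal)) ∧ ∀ x y, |g x - g y| ≤ dist x y) ↔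
      cTransform (fun x y : X => -dist x y) f = fun y => -f y) ∧
    ((cTransform (fun x y : X => -dist x y) f = fun y => -f y) ↔
      CConvexWith (fun x y : X => -dist x y) f) ∧
    (CConvexWith (fun x y : X => -dist x y) f ↔
      ∀ x, x ∈ cSubdiff (fun x y : X => -dist x y) f x) ∧
    ((∃ g : X → ℝ, (∀ x, f x = (g x : EReal)) ∧ ∀ x y, |g x - g y| ≤ dist x y) →
      (∀ x, f x ≠ ⊤) ∧
      ∀ x y, (y ∈ cSubdiff (fun x y : X => -dist x y) f x ↔
        f y - f x = (dist x y : EReal))) := by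
  have lip_iff_diag : (∃ g : X → ℝ, (∀ x, f x = (g x : EReal)) ∧
      ∀ x y, |g x - g y| ≤ dist x y) ↔ ∀ x x', f x ≤ f x' + (dist x x' : EReal) := by
    refine ⟨?_, hf.exists_lipschitz⟩
    rintro ⟨g, hfg, hg⟩
    obtain rfl : f = fun x => (g x : EReal) := funext hfg
    exact (cConvexWith_negDist_of_lipschitz hg).le_add_dist
  have transform_iff_diag : cTransform (fun x y : X => -dist x y) f = (fun y => -f y) ↔
      ∀ x x', f x ≤ f x' + (dist x x' : EReal) := by
    refine ⟨le_add_dist_of_cTransform_negDist_eq_neg, fun h => ?_⟩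
    obtain ⟨g, hfg, hg⟩ := hf.exists_lipschitz h
    obtain rfl : f = fun x => (g x : EReal) := funext hfg
    exact cTransform_negDist_of_lipschitz hg
  have convex_iff_diag : CConvexWith (fun x y : X => -dist x y) f ↔
      ∀ x x', f x ≤ f x' + (dist x x' : EReal) := by
    refine ⟨CConvexWith.le_add_dist, fun h => ?_⟩
    obtain ⟨g, hfg, hg⟩ := hf.exists_lipschitz h
    obtain rfl : f = fun x => (g x : EReal) := funext hfg
    exact cConvexWith_negDist_of_lipschitz hg
  refine ⟨lip_iff_diag.trans transform_iff_diag.symm,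
    transform_iff_diag.trans convex_iff_diag.symm,
    convex_iff_diag.trans forall_mem_cSubdiff_negDist_self_iff.symm, ?_⟩
  rintro ⟨g, hfg, hg⟩
  obtain rfl : f = fun x => (g x : EReal) := funext hfg
  exact ⟨fun _ => EReal.coe_ne_top _, mem_cSubdiff_negDist_iff_of_lipschitz hg⟩
end

section
/- Let (X,d) be a metric space, let A ⊆ X, let f : A → ℝ be 1-Lipschitz on A, and let M : A ⇉ A be a multivalued mapping such that f(y) − f(x) = d(x,y) for all (x,y) ∈ G(M). Given a nonempty S ⊆ dom M, the function f|_S extends to a 1-Lipschitz function h : X → ℝ satisfying h(y) − h(x) = d(x,y) for all (x,y) ∈ G(M). Moreover, among all 1-Lipschitz functions h : X → ℝ with h|_S = f|_S and h(y) − h(x) = d(x,y) for all (x,y) ∈ G(M), there exist a pointwise minimal one and a pointwise maximal one. -/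
/-- The `1`-Lipschitz functions that agree with `f` on `S` and grow at unit rate along every
pair of the relation `R`. -/
def constrainedExtensions {X : Type*} [MetricSpace X] (f : X → ℝ) (R : X → X → Prop)
    (S : Set X) : Set (X → ℝ) :=
  {h | (∀ x y, |h x - h y| ≤ dist x y) ∧ (∀ s ∈ S, h s = f s) ∧
    ∀ x y, R x y → h y - h x = dist x y}

/-- **McShane extension** of a `1`-Lipschitz function, in terms of absolute values. -/
theorem exists_oneLipschitz_extension {X : Type*} [MetricSpace X] {A : Set X} {f : X → ℝ}
    (hf : ∀ x ∈ A, ∀ y ∈ A, |f x - f y| ≤ dist x y) :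
    ∃ h : X → ℝ, (∀ x y, |h x - h y| ≤ dist x y) ∧ ∀ x ∈ A, h x = f x := by
  have hL : LipschitzOnWith 1 f A := LipschitzOnWith.of_dist_le_mul fun x hx y hy => by
    simpa [Real.dist_eq] using hf x hx y hy
  obtain ⟨h, hh, heq⟩ := hL.extend_real
  exact ⟨h, fun x y => by simpa [Real.dist_eq] using hh.dist_le_mul x y,
    fun x hx => (heq hx).symm⟩

/-- The pointwise infimum of all constrained extensions is again one. -/
theorem exists_isLeast_constrainedExtensions {X : Type*} [MetricSpace X] {f : X → ℝ}
    {R : X → X → Prop} {S : Set X} (hS : S.Nonempty)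
    (hne : (constrainedExtensions f R S).Nonempty) :
    ∃ h, IsLeast (constrainedExtensions f R S) h := by
  obtain ⟨s, hs⟩ := hS
  have : Nonempty (constrainedExtensions f R S) := hne.to_subtype
  have hbdd (x : X) : BddBelow (Set.range fun h : constrainedExtensions f R S => h.1 x) := by
    refine ⟨f s - dist s x, ?_⟩
    rintro _ ⟨h, rfl⟩
    have h1 := (abs_le.1 (h.2.1 s x)).2
    rw [h.2.2.1 s hs] at h1
    dsimp only
    linarith
  have hle (h : constrainedExtensions f R S) (x : X) :
      ⨅ g : constrainedExtensions f R S, g.1 x ≤ h.1 x := ciInf_le (hbdd x) h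
  have hlip (x y : X) : ⨅ g : constrainedExtensions f R S, g.1 x ≤
      (⨅ g : constrainedExtensions f R S, g.1 y) + dist x y := by
    rw [← sub_le_iff_le_add]
    refine le_ciInf fun h => ?_
    linarith [hle h x, (abs_le.1 (h.2.1 x y)).2]
  refine ⟨fun x => ⨅ h : constrainedExtensions f R S, h.1 x, ⟨fun x y => ?_, fun t ht => ?_,
    fun x y hxy => ?_⟩, fun h hh x => hle ⟨h, hh⟩ x⟩
  · rw [abs_sub_le_iff]
    constructor
    · linarith [hlip x y]
    · linarith [hlip y x, dist_comm x y]
  · simp [fun h : constrainedExtensions f R S => h.2.2.1 t ht]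
  · have hge : (⨅ g : constrainedExtensions f R S, g.1 x) + dist x y ≤
        ⨅ g : constrainedExtensions f R S, g.1 y :=
      le_ciInf fun h => by linarith [hle h x, h.2.2.2 x y hxy]
    dsimp only
    linarith [hlip y x, dist_comm x y]

theorem neg_mem_constrainedExtensions {X : Type*} [MetricSpace X] {f h : X → ℝ}
    {R : X → X → Prop} {S : Set X} (hh : h ∈ constrainedExtensions f R S) :
    -h ∈ constrainedExtensions (-f) (fun x y => R y x) S := by
  refine ⟨fun x y => ?_, fun s hs => by simp [hh.2.1 s hs], fun x y hxy => ?_⟩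
  · simpa [abs_sub_comm, neg_add_eq_sub] using hh.1 x y
  · rw [dist_comm, ← hh.2.2 y x hxy]
    simp [neg_add_eq_sub]

theorem exists_isGreatest_constrainedExtensions {X : Type*} [MetricSpace X] {f : X → ℝ}
    {R : X → X → Prop} {S : Set X} (hS : S.Nonempty)
    (hne : (constrainedExtensions f R S).Nonempty) :
    ∃ h, IsGreatest (constrainedExtensions f R S) h := by
  obtain ⟨g, hg, hmin⟩ := exists_isLeast_constrainedExtensions hS
    (f := -f) (R := fun x y => R y x)
    (hne.elim fun _ hh => ⟨_, neg_mem_constrainedExtensions hh⟩)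
  refine ⟨-g, by simpa using neg_mem_constrainedExtensions hg, fun h hh => ?_⟩
  exact le_neg_of_le_neg (hmin (neg_mem_constrainedExtensions hh))


/-- constrained Lipschitz extension: a `1`-Lipschitz `f : A → ℝ` with
`f(y) − f(x) = d(x,y)` on `G(M)` (where `G(M) ⊆ A × A`) extends, from any nonempty
`S ⊆ dom M`, to a `1`-Lipschitz function on all of `X` preserving the constraint;
moreover there are a pointwise minimal and a pointwise maximal such extension. -/
theorem constrained_lipschitz_extension {X : Type*} [MetricSpace X]
    (A : Set X) (f : X → ℝ) (hfLip : ∀ x ∈ A, ∀ y ∈ A, |f x - f y| ≤ dist x y)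
    (M : X → Set X) (hMA : ∀ x y, y ∈ M x → x ∈ A ∧ y ∈ A)
    (hfM : ∀ x y, y ∈ M x → f y - f x = dist x y)
    (S : Set X) (hS : S.Nonempty) (hSdom : ∀ s ∈ S, (M s).Nonempty) :
    (∃ h : X → ℝ, (∀ x y, |h x - h y| ≤ dist x y) ∧ (∀ s ∈ S, h s = f s) ∧
      ∀ x y, y ∈ M x → h y - h x = dist x y) ∧
    (∃ hmin : X → ℝ, ((∀ x y, |hmin x - hmin y| ≤ dist x y) ∧ (∀ s ∈ S, hmin s = f s) ∧
        ∀ x y, y ∈ M x → hmin y - hmin x = dist x y) ∧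
      ∀ h : X → ℝ, ((∀ x y, |h x - h y| ≤ dist x y) ∧ (∀ s ∈ S, h s = f s) ∧
        ∀ x y, y ∈ M x → h y - h x = dist x y) → ∀ x, hmin x ≤ h x) ∧
    (∃ hmax : X → ℝ, ((∀ x y, |hmax x - hmax y| ≤ dist x y) ∧ (∀ s ∈ S, hmax s = f s) ∧
        ∀ x y, y ∈ M x → hmax y - hmax x = dist x y) ∧
      ∀ h : X → ℝ, ((∀ x y, |h x - h y| ≤ dist x y) ∧ (∀ s ∈ S, h s = f s) ∧
        ∀ x y, y ∈ M x → h y - h x = dist x y) → ∀ x, h x ≤ hmax x) := by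
  have hSA : S ⊆ A := fun s hs => (hSdom s hs).elim fun y hy => (hMA s y hy).1
  have hne : (constrainedExtensions f (fun x y => y ∈ M x) S).Nonempty := by
    obtain ⟨h, hlip, heq⟩ := exists_oneLipschitz_extension hfLip
    refine ⟨h, hlip, fun s hs => heq s (hSA hs), fun x y hxy => ?_⟩
    rw [heq x (hMA x y hxy).1, heq y (hMA x y hxy).2, hfM x y hxy]
  obtain ⟨hmin, hmin_mem, hmin_le⟩ := exists_isLeast_constrainedExtensions hS hne
  obtain ⟨hmax, hmax_mem, le_hmax⟩ := exists_isGreatest_constrainedExtensions hS hne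
  exact ⟨hne, ⟨hmin, hmin_mem, fun _ hh => hmin_le hh⟩, ⟨hmax, hmax_mem, fun _ hh => le_hmax hh⟩⟩
end

section
/- Let (X,d) be a metric space, let M : X ⇉ X be a multivalued mapping with dom M ≠ ∅, and let f : dom M → ℝ satisfy f(x) − f(x') ≤ d(x',y) − d(x,y) for all (x,y) ∈ G(M) and all x' ∈ dom M. Let ∅ ≠ S ⊆ dom M. Define α(x) := sup, over s ∈ S, n ∈ ℕ and (x_1,y_1),…,(x_n,y_n) ∈ G(M) with x_1 = s, of f(s) + Σ_{i=1}^{n−1} [d(x_i,y_i) − d(x_{i+1},y_i)] + d(x_n,y_n) − d(x,y_n), and γ(x) := inf, over the same data, of f(s) + Σ_{i=1}^{n−1} [d(x_i,y_{i+1}) − d(x_{i+1},y_{i+1})] + d(x_n,x). Then α and γ are real-valued 1-Lipschitz functions on X agreeing with f on S and satisfying h(x) − h(x') ≤ d(x',y) − d(x,y) for all (x,y) ∈ G(M) and x' ∈ X (with h = α, γ respectively); α is the pointwise minimal and γ the pointwise maximal 1-Lipschitz function on X with these two properties. -/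
/-- A `1`-Lipschitz function on `X` agreeing with `f` on `S` and satisfying
`h(x) − h(x') ≤ d(x',y) − d(x,y)` for all `(x,y) ∈ G(M)` and `x' ∈ X`. -/
def IsConstrainedLipExt {X : Type*} [MetricSpace X] (M : X → Set X) (S : Set X)
    (f : X → ℝ) (h : X → ℝ) : Prop :=
  (∀ x y, |h x - h y| ≤ dist x y) ∧ (∀ s ∈ S, h s = f s) ∧
    ∀ x y, y ∈ M x → ∀ x', h x - h x' ≤ dist x' y - dist x y

section Chains

variable {X : Type*} [MetricSpace X]

/-- The values at `x` of the chains whose supremum is the minimal extension. -/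
def lowerChainValues (M : X → Set X) (S : Set X) (f : X → ℝ) (x : X) : Set ℝ :=
  {r : ℝ | ∃ (n : ℕ) (xs : Fin (n + 1) → X) (ys : Fin (n + 1) → X),
    xs 0 ∈ S ∧ (∀ i, ys i ∈ M (xs i)) ∧
    r = f (xs 0) +
      (∑ i : Fin n, (dist (xs i.castSucc) (ys i.castSucc) - dist (xs i.succ) (ys i.castSucc))) +
      dist (xs (Fin.last n)) (ys (Fin.last n)) - dist x (ys (Fin.last n))}

/-- The values at `x` of the chains whose infimum is the maximal extension. -/
def upperChainValues (M : X → Set X) (S : Set X) (f : X → ℝ) (x : X) : Set ℝ :=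
  {r : ℝ | ∃ (n : ℕ) (xs : Fin (n + 1) → X) (ys : Fin (n + 1) → X),
    xs 0 ∈ S ∧ (∀ i, ys i ∈ M (xs i)) ∧
    r = f (xs 0) +
      (∑ i : Fin n, (dist (xs i.castSucc) (ys i.succ) - dist (xs i.succ) (ys i.succ))) +
      dist (xs (Fin.last n)) x}

theorem Fin.sum_succ_sub_castSucc {n : ℕ} (u : Fin (n + 1) → ℝ) :
    ∑ i : Fin n, (u i.succ - u i.castSucc) = u (Fin.last n) - u 0 := by
  induction n with
  | zero => simp
  | succ n ih =>
    rw [Fin.sum_univ_castSucc]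
    have := ih fun i => u i.castSucc
    simp only [Fin.castSucc_zero, ← Fin.succ_castSucc] at this ⊢
    rw [this, Fin.succ_last]
    ring

variable {M : X → Set X} {S : Set X} {f : X → ℝ}

theorem mem_lowerChainValues_self {s : X} (hs : s ∈ S) (hM : (M s).Nonempty) :
    f s ∈ lowerChainValues M S f s := by
  obtain ⟨y, hy⟩ := hM
  exact ⟨0, fun _ => s, fun _ => y, hs, fun _ => hy, by simp⟩

theorem mem_upperChainValues_self {s : X} (hs : s ∈ S) (hM : (M s).Nonempty) :
    f s ∈ upperChainValues M S f s := by
  obtain ⟨y, hy⟩ := hM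
  exact ⟨0, fun _ => s, fun _ => y, hs, fun _ => hy, by simp⟩

theorem exists_mem_lowerChainValues_dist {x : X} {r : ℝ} (hr : r ∈ lowerChainValues M S f x)
    (x' : X) : ∃ r' ∈ lowerChainValues M S f x', r ≤ r' + dist x x' := by
  obtain ⟨n, xs, ys, h0, hys, rfl⟩ := hr
  refine ⟨_, ⟨n, xs, ys, h0, hys, rfl⟩, ?_⟩
  linarith [dist_triangle_left x' (ys (Fin.last n)) x]

theorem exists_mem_upperChainValues_dist {x : X} {r : ℝ} (hr : r ∈ upperChainValues M S f x)
    (x' : X) : ∃ r' ∈ upperChainValues M S f x', r' ≤ r + dist x x' := by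
  obtain ⟨n, xs, ys, h0, hys, rfl⟩ := hr
  refine ⟨_, ⟨n, xs, ys, h0, hys, rfl⟩, ?_⟩
  linarith [dist_triangle (xs (Fin.last n)) x x']

theorem lowerChainValues_snoc {x y : X} {r : ℝ} (hr : r ∈ lowerChainValues M S f x)
    (hy : y ∈ M x) (x' : X) : r + dist x y - dist x' y ∈ lowerChainValues M S f x' := by
  obtain ⟨n, xs, ys, h0, hys, rfl⟩ := hr
  have h0' : Fin.snoc (α := fun _ => X) xs x 0 = xs 0 :=
    Fin.snoc_castSucc (α := fun _ => X) x xs 0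
  refine ⟨n + 1, Fin.snoc (α := fun _ => X) xs x, Fin.snoc (α := fun _ => X) ys y, ?_, ?_, ?_⟩
  · rwa [h0']
  · intro i
    refine Fin.lastCases ?_ (fun i => ?_) i
    · simpa using hy
    · simpa using hys i
  · rw [Fin.sum_univ_castSucc, h0']
    simp only [Fin.succ_castSucc, Fin.succ_last, Fin.snoc_castSucc, Fin.snoc_last]
    ring

theorem exists_mem_upperChainValues_snoc {x' : X} {r : ℝ} (hr : r ∈ upperChainValues M S f x')
    {x y : X} (hy : y ∈ M x) :
    ∃ r' ∈ upperChainValues M S f x, r' ≤ r + dist x' y - dist x y := by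
  obtain ⟨n, xs, ys, h0, hys, rfl⟩ := hr
  have h0' : Fin.snoc (α := fun _ => X) xs x 0 = xs 0 :=
    Fin.snoc_castSucc (α := fun _ => X) x xs 0
  refine ⟨_, ⟨n + 1, Fin.snoc (α := fun _ => X) xs x, Fin.snoc (α := fun _ => X) ys y,
    ?_, ?_, rfl⟩, ?_⟩
  · rwa [h0']
  · intro i
    refine Fin.lastCases ?_ (fun i => ?_) i
    · simpa using hy
    · simpa using hys i
  · rw [Fin.sum_univ_castSucc, h0']
    simp only [Fin.succ_castSucc, Fin.succ_last, Fin.snoc_castSucc, Fin.snoc_last, dist_self]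
    linarith [dist_triangle (xs (Fin.last n)) x' y]

variable {D : Set X} {g : X → ℝ}

theorem le_of_mem_lowerChainValues (hD : ∀ x, (M x).Nonempty → x ∈ D)
    (hg : ∀ x y, y ∈ M x → ∀ x' ∈ D, g x - g x' ≤ dist x' y - dist x y)
    (hgf : ∀ s ∈ S, g s = f s) {x : X} (hx : x ∈ D) {r : ℝ}
    (hr : r ∈ lowerChainValues M S f x) : r ≤ g x := by
  obtain ⟨n, xs, ys, h0, hys, rfl⟩ := hr
  have hsum := Finset.sum_le_sum fun (i : Fin n) (_ : i ∈ Finset.univ) =>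
    show dist (xs i.castSucc) (ys i.castSucc) - dist (xs i.succ) (ys i.castSucc) ≤
        g (xs i.succ) - g (xs i.castSucc) by
      linarith [hg _ _ (hys i.castSucc) _ (hD _ ⟨_, hys i.succ⟩)]
  rw [Fin.sum_succ_sub_castSucc fun i => g (xs i)] at hsum
  linarith [hg _ _ (hys (Fin.last n)) x hx, hgf _ h0]

theorem le_of_mem_upperChainValues (hD : ∀ x, (M x).Nonempty → x ∈ D)
    (hg : ∀ x y, y ∈ M x → ∀ x' ∈ D, g x - g x' ≤ dist x' y - dist x y)
    (hLip : ∀ x ∈ D, ∀ x' ∈ D, g x - g x' ≤ dist x' x)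
    (hgf : ∀ s ∈ S, g s = f s) {x : X} (hx : x ∈ D) {r : ℝ}
    (hr : r ∈ upperChainValues M S f x) : g x ≤ r := by
  obtain ⟨n, xs, ys, h0, hys, rfl⟩ := hr
  have hsum := Finset.sum_le_sum fun (i : Fin n) (_ : i ∈ Finset.univ) =>
    show g (xs i.succ) - g (xs i.castSucc) ≤
        dist (xs i.castSucc) (ys i.succ) - dist (xs i.succ) (ys i.succ) from
      hg _ _ (hys i.succ) _ (hD _ ⟨_, hys i.castSucc⟩)
  rw [Fin.sum_succ_sub_castSucc fun i => g (xs i)] at hsum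
  linarith [hLip x hx _ (hD _ ⟨_, hys (Fin.last n)⟩), hgf _ h0]

theorem isConstrainedLipExt_of_isLUB (hSM : ∀ s ∈ S, (M s).Nonempty) {α : X → ℝ}
    (hα : ∀ x, IsLUB (lowerChainValues M S f x) (α x))
    (hf : ∀ s ∈ S, ∀ r ∈ lowerChainValues M S f s, r ≤ f s) :
    IsConstrainedLipExt M S f α := by
  have hLip : ∀ x x', α x ≤ α x' + dist x x' := fun x x' => (hα x).2 fun r hr => by
    obtain ⟨r', hr', h⟩ := exists_mem_lowerChainValues_dist hr x'
    linarith [(hα x').1 hr']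
  refine ⟨fun x x' => ?_, fun s hs => ?_, fun x y hy x' => ?_⟩
  · rw [abs_sub_le_iff]
    constructor <;> linarith [hLip x x', hLip x' x, dist_comm x x']
  · exact le_antisymm ((hα s).2 (hf s hs)) ((hα s).1 (mem_lowerChainValues_self hs (hSM s hs)))
  · suffices α x ≤ α x' + dist x' y - dist x y by linarith
    refine (hα x).2 fun r hr => ?_
    linarith [(hα x').1 (lowerChainValues_snoc hr hy x')]

theorem isConstrainedLipExt_of_isGLB (hSM : ∀ s ∈ S, (M s).Nonempty) {γ : X → ℝ}
    (hγ : ∀ x, IsGLB (upperChainValues M S f x) (γ x))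
    (hf : ∀ s ∈ S, ∀ r ∈ upperChainValues M S f s, f s ≤ r) :
    IsConstrainedLipExt M S f γ := by
  have hLip : ∀ x x', γ x' - dist x x' ≤ γ x := fun x x' => (hγ x).2 fun r hr => by
    obtain ⟨r', hr', h⟩ := exists_mem_upperChainValues_dist hr x'
    linarith [(hγ x').1 hr']
  refine ⟨fun x x' => ?_, fun s hs => ?_, fun x y hy x' => ?_⟩
  · rw [abs_sub_le_iff]
    constructor <;> linarith [hLip x x', hLip x' x, dist_comm x x']
  · exact le_antisymm ((hγ s).1 (mem_upperChainValues_self hs (hSM s hs))) ((hγ s).2 (hf s hs))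
  · suffices γ x - dist x' y + dist x y ≤ γ x' by linarith
    refine (hγ x').2 fun r hr => ?_
    obtain ⟨r', hr', h⟩ := exists_mem_upperChainValues_snoc hr hy
    linarith [(hγ x).1 hr']

end Chains

/-- the explicit chain formulae give the minimal extension `α` and the
maximal extension `γ` among all `1`-Lipschitz functions on `X` agreeing with `f` on `S`
and compatible with `M`. -/
theorem optimal_constrained_lipschitz_extensions {X : Type*} [MetricSpace X]
    (M : X → Set X) (hM : ∃ x, (M x).Nonempty) (f : X → ℝ)
    (hf : ∀ x y, y ∈ M x → ∀ x', (M x').Nonempty → f x - f x' ≤ dist x' y - dist x y)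
    (S : Set X) (hS : S.Nonempty) (hSdom : ∀ s ∈ S, (M s).Nonempty)
    (α γ : X → ℝ)
    (hα : ∀ x, α x = sSup {r : ℝ | ∃ (n : ℕ) (xs : Fin (n + 1) → X) (ys : Fin (n + 1) → X),
      xs 0 ∈ S ∧ (∀ i, ys i ∈ M (xs i)) ∧
      r = f (xs 0) +
        (∑ i : Fin n, (dist (xs i.castSucc) (ys i.castSucc) - dist (xs i.succ) (ys i.castSucc))) +
        dist (xs (Fin.last n)) (ys (Fin.last n)) - dist x (ys (Fin.last n))})
    (hγ : ∀ x, γ x = sInf {r : ℝ | ∃ (n : ℕ) (xs : Fin (n + 1) → X) (ys : Fin (n + 1) → X),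
      xs 0 ∈ S ∧ (∀ i, ys i ∈ M (xs i)) ∧
      r = f (xs 0) +
        (∑ i : Fin n, (dist (xs i.castSucc) (ys i.succ) - dist (xs i.succ) (ys i.succ))) +
        dist (xs (Fin.last n)) x}) :
    IsConstrainedLipExt M S f α ∧ IsConstrainedLipExt M S f γ ∧
    (∀ h : X → ℝ, IsConstrainedLipExt M S f h → ∀ x, α x ≤ h x ∧ h x ≤ γ x) := by
  have hLip : ∀ x ∈ {x | (M x).Nonempty}, ∀ x' ∈ {x | (M x).Nonempty},
      f x - f x' ≤ dist x' x := by
    rintro x ⟨y, hy⟩ x' hx'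
    linarith [hf x y hy x' hx', dist_triangle x' x y]
  have hlow : ∀ x, (M x).Nonempty → ∀ r ∈ lowerChainValues M S f x, r ≤ f x :=
    fun x hx r => le_of_mem_lowerChainValues (D := {x | (M x).Nonempty}) (fun _ => id) hf
      (fun _ _ => rfl) hx
  have hupp : ∀ x, (M x).Nonempty → ∀ r ∈ upperChainValues M S f x, f x ≤ r :=
    fun x hx r => le_of_mem_upperChainValues (D := {x | (M x).Nonempty}) (fun _ => id) hf hLip
      (fun _ _ => rfl) hx
  obtain ⟨s, hs⟩ := hS
  have hsM := hSdom s hs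
  have hαLUB : ∀ x, IsLUB (lowerChainValues M S f x) (α x) := fun x => by
    rw [hα x]
    refine isLUB_csSup ?_ ⟨f s + dist x s, fun r hr => ?_⟩
    · obtain ⟨r, hr, -⟩ := exists_mem_lowerChainValues_dist
        (mem_lowerChainValues_self (f := f) hs hsM) x
      exact ⟨r, hr⟩
    · obtain ⟨r', hr', h⟩ := exists_mem_lowerChainValues_dist hr s
      linarith [hlow s hsM r' hr']
  have hγGLB : ∀ x, IsGLB (upperChainValues M S f x) (γ x) := fun x => by
    rw [hγ x]
    refine isGLB_csInf ?_ ⟨f s - dist x s, fun r hr => ?_⟩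
    · obtain ⟨r, hr, -⟩ := exists_mem_upperChainValues_dist
        (mem_upperChainValues_self (f := f) hs hsM) x
      exact ⟨r, hr⟩
    · obtain ⟨r', hr', h⟩ := exists_mem_upperChainValues_dist hr s
      linarith [hupp s hsM r' hr']
  refine ⟨isConstrainedLipExt_of_isLUB hSdom hαLUB fun s hs => hlow s (hSdom s hs),
    isConstrainedLipExt_of_isGLB hSdom hγGLB fun s hs => hupp s (hSdom s hs), ?_⟩
  rintro h ⟨hhLip, hhf, hhM⟩ x
  have hhM' : ∀ x y, y ∈ M x → ∀ x' ∈ Set.univ, h x - h x' ≤ dist x' y - dist x y :=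
    fun x y hy x' _ => hhM x y hy x'
  refine ⟨(hαLUB x).2 fun r => le_of_mem_lowerChainValues (fun _ _ => trivial) hhM' hhf trivial,
    (hγGLB x).2 fun r => le_of_mem_upperChainValues (fun _ _ => trivial) hhM' ?_ hhf trivial⟩
  intro x _ x' _
  rw [dist_comm]
  exact (le_abs_self _).trans (hhLip x x')
end
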